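/- arXiv:2406.07523 — 2 statements merged into one kernel-verified Lean document; each statement's English description precedes it below -/
import Mathlib

section
/- Let π ∈ M̂ with pushforward μ̂ under (x₀,x₁,u) ↦ (x₀,u), and let μ denote the first marginal of μ̂. Then the disintegrations satisfy: (i) for Ŝ(μ̂)-almost every (y₀,u), the conditional law of the second coordinate of Ŝ(π) given (y₀,u) equals S(π_{(1/y₀,u)}), where π_{(x₀,u)} is the disintegration of π over μ̂; and (ii) for S(μ)-almost every y₀, the disintegration of Ŝ(μ̂) over its first marginal S(μ) satisfies Ŝ(μ̂)_{y₀} = μ̂_{1/y₀}, where μ̂_{x₀} is the disintegration of μ̂ over μ. -/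
open MeasureTheory Set

/-- Barycenter of a measure on `ℝ`. -/
noncomputable def bary (mu : Measure ℝ) : ℝ := ∫ x, x ∂mu

/-- `mu ∈ P₁((0,∞))`: Borel probability measure on `ℝ` concentrated on `(0,∞)`
with finite first moment. -/
def MemP1 (mu : Measure ℝ) : Prop :=
  IsProbabilityMeasure mu ∧ mu (Set.Ioi (0:ℝ))ᶜ = 0 ∧ Integrable id mu

/-- Change-of-numeraire transform of a measure on `ℝ`:
`S(mu)(B) = (1/b(mu)) ∫ x · 1_B(1/x) dmu(x)`. -/
noncomputable def S (mu : Measure ℝ) : Measure ℝ :=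
  (ENNReal.ofReal (bary mu))⁻¹ •
    ((mu.withDensity fun x => ENNReal.ofReal x).map fun x => x⁻¹)


/-- Extended change-of-numeraire transform on measures on `(0,∞)² × [0,1]`
(coordinates `(x₀, x₁, u)`):
`Ŝ(π)(B) = (∫ x₁ · 1_B(1/x₀, 1/x₁, u) dπ) / (∫ x₁ dπ)`. -/
noncomputable def Shat (pi : Measure (ℝ × ℝ × ℝ)) : Measure (ℝ × ℝ × ℝ) :=
  (ENNReal.ofReal (∫ p, p.2.1 ∂pi))⁻¹ •
    ((pi.withDensity fun p => ENNReal.ofReal p.2.1).map fun p => (p.1⁻¹, p.2.1⁻¹, p.2.2))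

/-- Extended change-of-numeraire transform on measures on `(0,∞) × [0,1]`
(coordinates `(x, u)`): `Ŝ(μ̂)(B) = (∫ x · 1_B(1/x, u) dμ̂) / (∫ x dμ̂)`. -/
noncomputable def ShatMu (m : Measure (ℝ × ℝ)) : Measure (ℝ × ℝ) :=
  (ENNReal.ofReal (∫ p, p.1 ∂m))⁻¹ •
    ((m.withDensity fun p => ENNReal.ofReal p.1).map fun p => (p.1⁻¹, p.2))

/-- A source: a Borel probability measure on `(0,∞) × [0,1]` with `∫ x dμ̂ < ∞`. -/
def MemSource (m : Measure (ℝ × ℝ)) : Prop :=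
  IsProbabilityMeasure m ∧
  m {p : ℝ × ℝ | 0 < p.1 ∧ p.2 ∈ Set.Icc (0:ℝ) 1}ᶜ = 0 ∧
  Integrable (fun p => p.1) m

/-- A Borel probability measure on `(0,∞)² × [0,1]` with `∫ x₁ dπ < ∞`. -/
def GoodTriple (pi : Measure (ℝ × ℝ × ℝ)) : Prop :=
  IsProbabilityMeasure pi ∧
  pi {p : ℝ × ℝ × ℝ | 0 < p.1 ∧ 0 < p.2.1 ∧ p.2.2 ∈ Set.Icc (0:ℝ) 1}ᶜ = 0 ∧
  Integrable (fun p => p.2.1) pi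

/-- `π ∈ M̂`: probability measure on `(0,∞)² × [0,1]` with `∫ x₁ dπ < ∞` such that
`∫ g(x₀,u)(x₁ - x₀) dπ = 0` for all bounded Borel `g`. -/
def MemMhat (pi : Measure (ℝ × ℝ × ℝ)) : Prop :=
  GoodTriple pi ∧
  ∀ g : ℝ × ℝ → ℝ, Measurable g → (∃ M, ∀ q, |g q| ≤ M) →
    ∫ p, g (p.1, p.2.2) * (p.2.1 - p.1) ∂pi = 0

/-- `π ∈ M̂(μ̂, ν)`: lifted martingale transport plans with source `μ̂` and
terminal marginal `ν`. -/
def MemMhatC (mhat : Measure (ℝ × ℝ)) (nu : Measure ℝ)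
    (pi : Measure (ℝ × ℝ × ℝ)) : Prop :=
  MemMhat pi ∧
  pi.map (fun p => (p.1, p.2.2)) = mhat ∧
  pi.map (fun p => p.2.1) = nu
open scoped Classical in
/-- Disintegration (conditional kernel) of a measure on a product space with respect to the
first coordinate; equal to `Measure.condKernel` for finite measures. -/
noncomputable def disint {α β : Type*} [MeasurableSpace α] [MeasurableSpace β]
    [StandardBorelSpace β] [Nonempty β] (rho : Measure (α × β)) : α → Measure β :=
  if h : IsFiniteMeasure rho then (letI := h; fun a => rho.condKernel a)
  else fun _ => 0


open ProbabilityTheory in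
lemma disint_eq_condKernel {α β : Type*} [MeasurableSpace α] [MeasurableSpace β]
    [StandardBorelSpace β] [Nonempty β] (ρ : Measure (α × β)) [h : IsFiniteMeasure ρ] (a : α) :
    disint ρ a = ρ.condKernel a := by
  rw [disint, dif_pos h]

/-- A property holding almost everywhere transfers to the image, under an involution, of a
measure with density. -/
lemma ae_smul_map_withDensity {α : Type*} [MeasurableSpace α] {m : Measure α} {g : α → ENNReal}
    {e : α → α} (he : Measurable e) (hee : Function.Involutive e) (c : ENNReal) {P : α → Prop}
    (hP : ∀ᵐ a ∂m, P a) : ∀ᵐ a ∂(c • (m.withDensity g).map e), P (e a) := by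
  refine Measure.ae_smul_measure ?_ c
  have h : Filter.Tendsto e (ae ((m.withDensity g).map e)) (ae (m.withDensity g)) := by
    have := (Measure.tendsto_ae_map (μ := (m.withDensity g).map e) he.aemeasurable)
    rwa [Measure.map_map he he, hee.comp_self, Measure.map_id] at this
  exact h.eventually ((withDensity_absolutelyContinuous m g).ae_le hP)

lemma map_withDensity_comp {α β : Type*} [MeasurableSpace α] [MeasurableSpace β] (m : Measure α)
    {φ : α → β} (hφ : Measurable φ) {f : β → ENNReal} (hf : Measurable f) :
    (m.withDensity fun a => f (φ a)).map φ = (m.map φ).withDensity f := by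
  ext s hs
  rw [Measure.map_apply hφ hs, withDensity_apply _ (hφ hs), withDensity_apply _ hs,
    setLIntegral_map hs hf hφ]

open ProbabilityTheory in
/-- Disintegration of the image of a reweighted measure `f · ρ` under a product map. -/
lemma disint_smul_map_withDensity {α β : Type*} [MeasurableSpace α] [MeasurableSpace β]
    [StandardBorelSpace β] [Nonempty β] (ρ : Measure (α × β)) [IsFiniteMeasure ρ]
    {f : α × β → ENNReal} (hf : Measurable f) {g : α → ENNReal} (hg : Measurable g)
    {e : α → α} (he : Measurable e) (hee : Function.Involutive e) {h : β → β} (hh : Measurable h)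
    (c : ENNReal) (hfg : ∀ᵐ a ∂ρ.fst, ∫⁻ b, f (a, b) ∂(disint ρ a) = g a)
    (hg0 : ∀ᵐ a ∂ρ.fst, g a ≠ 0) (hg1 : ∀ᵐ a ∂ρ.fst, g a ≠ ⊤)
    (hfin : IsFiniteMeasure (c • (ρ.withDensity f).map (Prod.map e h))) :
    ∀ᵐ a ∂(c • (ρ.fst.withDensity g).map e),
      disint (c • (ρ.withDensity f).map (Prod.map e h)) a
        = (g (e a))⁻¹ • ((disint ρ (e a)).withDensity fun b => f (e a, b)).map h := by
  simp only [disint_eq_condKernel] at hfg ⊢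
  set ρ' := c • (ρ.withDensity f).map (Prod.map e h) with hρ'
  have hG : Measurable fun a => ∫⁻ b, f (a, b) ∂(ρ.condKernel a) :=
    hf.lintegral_kernel_prod_right'
  set F : α → β → ENNReal := fun a b => (∫⁻ b, f (a, b) ∂(ρ.condKernel a))⁻¹ * f (a, b)
  have hFm : Measurable (Function.uncurry F) := (hG.comp measurable_fst).inv.mul hf
  set η : Kernel α β := ((ρ.condKernel.withDensity F).map h).comap e he with hη
  have hηa (a : α) : η a = ((∫⁻ b, f (e a, b) ∂(ρ.condKernel (e a)))⁻¹ •
      ((ρ.condKernel (e a)).withDensity fun b => f (e a, b))).map h := by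
    rw [hη, Kernel.comap_apply, Kernel.map_apply _ hh, Kernel.withDensity_apply _ hFm]
    exact congrArg _ (withDensity_smul _ (hf.comp measurable_prodMk_left))
  have hηfin : IsFiniteKernel η := by
    refine ⟨⟨1, ENNReal.one_lt_top, fun a => ?_⟩⟩
    rw [hηa, Measure.map_apply hh MeasurableSet.univ, Measure.smul_apply, Set.preimage_univ,
      withDensity_apply _ MeasurableSet.univ, Measure.restrict_univ, smul_eq_mul]
    exact ENNReal.inv_mul_le_one _
  have hprod : ∀ {s : Set α} {t : Set β}, MeasurableSet s → MeasurableSet t →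
      ρ' (s ×ˢ t) = c * ∫⁻ a in e ⁻¹' s, ∫⁻ b in h ⁻¹' t, f (a, b) ∂(ρ.condKernel a) ∂ρ.fst := by
    intro s t hs ht
    rw [hρ', Measure.smul_apply, Measure.map_apply (he.prodMap hh) (hs.prod ht),
      Set.preimage_prod_map_prod, withDensity_apply _ ((he hs).prod (hh ht)),
      Measure.setLIntegral_condKernel hf (he hs) (hh ht), smul_eq_mul]
  have hfst : ρ'.fst = c • (ρ.fst.withDensity g).map e := by
    ext s hs
    rw [Measure.fst_apply hs, ← Set.prod_univ, hprod hs MeasurableSet.univ, Measure.smul_apply,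
      Measure.map_apply he hs, withDensity_apply _ (he hs), smul_eq_mul]
    congr 1
    refine lintegral_congr_ae (ae_restrict_of_ae ?_)
    filter_upwards [hfg] with a ha
    rw [Set.preimage_univ, Measure.restrict_univ, ha]
  have hcomp : ρ' = ρ'.fst ⊗ₘ η := by
    refine Measure.ext_prod fun {s t} hs ht => ?_
    rw [hprod hs ht, Measure.compProd_apply_prod hs ht, hfst, Measure.restrict_smul,
      lintegral_smul_measure, smul_eq_mul, setLIntegral_map hs (Kernel.measurable_coe _ ht) he,
      setLIntegral_withDensity_eq_setLIntegral_mul (g := fun a => η (e a) t) _ hg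
        ((Kernel.measurable_coe _ ht).comp he) (he hs)]
    congr 1
    refine lintegral_congr_ae (ae_restrict_of_ae ?_)
    filter_upwards [hfg, hg0, hg1] with a ha h0 h1
    rw [Pi.mul_apply, hηa, hee a, Measure.map_apply hh ht, Measure.smul_apply,
      withDensity_apply _ (hh ht), ha, smul_eq_mul, ← mul_assoc, ENNReal.mul_inv_cancel h0 h1,
      one_mul]
  have key := eq_condKernel_of_measure_eq_compProd η hcomp
  rw [hfst] at key
  filter_upwards [key, ae_smul_map_withDensity he hee c hfg] with a ha hga
  rw [← ha, hηa, hga, Measure.map_smul]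

lemma GoodTriple.ae_pos {pi : Measure (ℝ × ℝ × ℝ)} (h : GoodTriple pi) :
    ∀ᵐ p ∂pi, 0 < p.1 ∧ 0 < p.2.1 :=
  (ae_iff.mpr h.2.1 : ∀ᵐ p ∂pi, 0 < p.1 ∧ 0 < p.2.1 ∧ p.2.2 ∈ Set.Icc (0:ℝ) 1).mono
    fun _ hp => ⟨hp.1, hp.2.1⟩

/-- The martingale condition says that `x₀` and `x₁` induce the same weighting of the source. -/
lemma MemMhat.withDensity_eq_map {pi : Measure (ℝ × ℝ × ℝ)} (hpi : MemMhat pi) :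
    (pi.map fun p => (p.1, p.2.2)).withDensity (fun q => ENNReal.ofReal q.1)
      = (pi.withDensity fun p => ENNReal.ofReal p.2.1).map fun p => (p.1, p.2.2) := by
  have : IsProbabilityMeasure pi := hpi.1.1
  have hφ : Measurable fun p : ℝ × ℝ × ℝ => (p.1, p.2.2) := by fun_prop
  have hU : ⋃ n : ℕ, {q : ℝ × ℝ | q.1 ≤ n} = Set.univ :=
    Set.eq_univ_of_forall fun q => Set.mem_iUnion.2 (exists_nat_ge q.1)
  refine (Measure.ext_iff_of_iUnion_eq_univ hU).2 fun n => ?_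
  have hn : MeasurableSet {q : ℝ × ℝ | q.1 ≤ n} := measurableSet_le measurable_fst measurable_const
  ext s hs
  rw [Measure.restrict_apply hs, Measure.restrict_apply hs]
  set t := s ∩ {q : ℝ × ℝ | q.1 ≤ n} with ht
  have htm : MeasurableSet t := hs.inter hn
  have htm' : MeasurableSet ((fun p : ℝ × ℝ × ℝ => (p.1, p.2.2)) ⁻¹' t) := hφ htm
  rw [withDensity_apply _ htm, setLIntegral_map htm (by fun_prop) hφ, Measure.map_apply hφ htm,
    withDensity_apply _ htm']
  have hpos := hpi.1.ae_pos
  have hi1 : IntegrableOn (fun p : ℝ × ℝ × ℝ => p.2.1)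
    ((fun p : ℝ × ℝ × ℝ => (p.1, p.2.2)) ⁻¹' t) pi := hpi.1.2.2.integrableOn
  have hi0 : IntegrableOn (fun p : ℝ × ℝ × ℝ => p.1)
      ((fun p : ℝ × ℝ × ℝ => (p.1, p.2.2)) ⁻¹' t) pi := by
    refine Measure.integrableOn_of_bounded (M := n) (measure_ne_top _ _)
      (by fun_prop) ?_
    filter_upwards [ae_restrict_of_ae hpos, ae_restrict_mem htm'] with p hp hpt
    rw [Real.norm_eq_abs, abs_of_pos hp.1]
    exact hpt.2
  have hz := hpi.2 (t.indicator fun _ => 1) (measurable_const.indicator htm)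
    ⟨1, fun q => by by_cases hq : q ∈ t <;> simp [hq]⟩
  have hz' : ∫ p in (fun p : ℝ × ℝ × ℝ => (p.1, p.2.2)) ⁻¹' t, (p.2.1 - p.1) ∂pi = 0 := by
    rw [← hz, ← integral_indicator htm']
    refine integral_congr_ae (Filter.Eventually.of_forall fun p => ?_)
    by_cases hp : (p.1, p.2.2) ∈ t <;> simp [hp]
  rw [integral_sub hi1 hi0, sub_eq_zero] at hz'
  rw [← ofReal_integral_eq_lintegral_ofReal hi0, ← ofReal_integral_eq_lintegral_ofReal hi1, hz']
  · exact ae_restrict_of_ae (hpos.mono fun p hp => hp.2.le)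
  · exact ae_restrict_of_ae (hpos.mono fun p hp => hp.1.le)

/-- disintegration identities for the extended change-of-numeraire
transform: (i) the conditional law of the second coordinate of `Ŝ(π)` given `(y₀,u)`
equals `S(π_{(1/y₀,u)})` for `Ŝ(μ̂)`-a.e. `(y₀,u)`; (ii) `Ŝ(μ̂)_{y₀} = μ̂_{1/y₀}` for
`S(μ)`-a.e. `y₀`. -/
theorem stmt15 (pi : Measure (ℝ × ℝ × ℝ)) (hpi : MemMhat pi)
    (mhat : Measure (ℝ × ℝ)) (hmhat : pi.map (fun p => (p.1, p.2.2)) = mhat)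
    (mu : Measure ℝ) (hmu : mu = mhat.map Prod.fst) :
    (∀ᵐ q ∂(ShatMu mhat),
      disint ((Shat pi).map fun p => ((p.1, p.2.2), p.2.1)) q
        = S (disint (pi.map fun p => ((p.1, p.2.2), p.2.1)) (q.1⁻¹, q.2))) ∧
    (∀ᵐ y0 ∂(S mu), disint (ShatMu mhat) y0 = disint mhat y0⁻¹) := by
  subst hmhat
  subst hmu
  have : IsProbabilityMeasure pi := hpi.1.1
  have hφ : Measurable fun p : ℝ × ℝ × ℝ => (p.1, p.2.2) := by fun_prop
  have hψ : Measurable fun p : ℝ × ℝ × ℝ => ((p.1, p.2.2), p.2.1) := by fun_prop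
  have hpos := hpi.1.ae_pos
  have hwd := hpi.withDensity_eq_map
  set mhat := pi.map fun p => (p.1, p.2.2)
  set ρ := pi.map fun p => ((p.1, p.2.2), p.2.1) with hρ
  have : IsProbabilityMeasure mhat := Measure.isProbabilityMeasure_map hφ.aemeasurable
  have : IsProbabilityMeasure ρ := Measure.isProbabilityMeasure_map hψ.aemeasurable
  have hfst : ρ.fst = mhat := by
    rw [Measure.fst, hρ, Measure.map_map measurable_fst hψ]
    rfl
  have hmpos : ∀ᵐ q ∂mhat, 0 < q.1 :=
    (ae_map_iff hφ.aemeasurable (measurableSet_lt measurable_const measurable_fst)).2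
      (hpos.mono fun p hp => hp.1)
  have hfin : IsFiniteMeasure (pi.withDensity fun p => ENNReal.ofReal p.2.1) :=
    isFiniteMeasure_withDensity_ofReal hpi.1.2.2.2
  have hfin' : IsFiniteMeasure (mhat.withDensity fun q => ENNReal.ofReal q.1) := by
    rw [hwd]; infer_instance
  have hint : ∫ q, q.1 ∂mhat = ∫ p, p.2.1 ∂pi := by
    rw [integral_eq_lintegral_of_nonneg_ae (hmpos.mono fun q hq => hq.le) (by fun_prop),
      integral_eq_lintegral_of_nonneg_ae (hpos.mono fun p hp => hp.2.le) (by fun_prop)]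
    have := congrArg (fun m => m Set.univ) hwd
    simp only [Measure.map_apply hφ MeasurableSet.univ, Set.preimage_univ,
      withDensity_apply _ MeasurableSet.univ, Measure.restrict_univ] at this
    rw [this]
  have hipos : 0 < ∫ p, p.2.1 ∂pi := by
    rw [integral_pos_iff_support_of_nonneg_ae (hpos.mono fun p hp => hp.2.le) hpi.1.2.2]
    have : Function.support (fun p : ℝ × ℝ × ℝ => p.2.1) =ᵐ[pi] Set.univ :=
      Filter.eventuallyEq_univ.2 (hpos.mono fun p hp => hp.2.ne')
    rw [measure_congr this]
    simp
  have hc : (ENNReal.ofReal (∫ p, p.2.1 ∂pi))⁻¹ ≠ ⊤ := by simpa using hipos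
  constructor
  · have hT : Measurable fun q : ℝ × ℝ => (q.1⁻¹, q.2) := by fun_prop
    have hTT : Function.Involutive fun q : ℝ × ℝ => (q.1⁻¹, q.2) := fun q => by simp
    have hShat : (Shat pi).map (fun p => ((p.1, p.2.2), p.2.1))
        = (ENNReal.ofReal (∫ p, p.2.1 ∂pi))⁻¹ • (ρ.withDensity fun x => ENNReal.ofReal x.2).map
          (Prod.map (fun q : ℝ × ℝ => (q.1⁻¹, q.2)) fun y : ℝ => y⁻¹) := by
      rw [Shat, Measure.map_smul, Measure.map_map hψ (by fun_prop), hρ,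
        ← map_withDensity_comp pi hψ (by fun_prop), Measure.map_map (by fun_prop) hψ]
      rfl
    have hfg : ∀ᵐ q ∂ρ.fst, ∫⁻ y, ENNReal.ofReal y ∂(disint ρ q) = ENNReal.ofReal q.1 := by
      simp only [disint_eq_condKernel]
      have hf : Measurable fun x : (ℝ × ℝ) × ℝ => ENNReal.ofReal x.2 := by fun_prop
      refine ae_eq_of_forall_setLIntegral_eq_of_sigmaFinite
        hf.lintegral_kernel_prod_right' (by fun_prop) fun s hs _ => ?_
      rw [Measure.setLIntegral_condKernel_univ_right hf hs, hfst, ← withDensity_apply _ hs, hwd,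
        Measure.map_apply hφ hs, withDensity_apply _ (hφ hs), hρ,
        setLIntegral_map (hs.prod MeasurableSet.univ) hf hψ, Set.prod_univ]
      rfl
    have hypos : ∀ᵐ q ∂ρ.fst, ∀ᵐ y ∂(disint ρ q), 0 < y := by
      simp only [disint_eq_condKernel]
      have : ∀ᵐ x ∂(ρ.fst.compProd ρ.condKernel), 0 < x.2 := by
        rw [ρ.disintegrate ρ.condKernel]
        exact (ae_map_iff hψ.aemeasurable (measurableSet_lt measurable_const measurable_snd)).2
          (hpos.mono fun p hp => hp.2)
      exact Measure.ae_ae_of_ae_compProd this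
    have hbary : ∀ᵐ q ∂ρ.fst, bary (disint ρ q) = q.1 := by
      filter_upwards [hfg, hypos, hfst ▸ hmpos] with q h1 h2 h3
      rw [bary, integral_eq_lintegral_of_nonneg_ae (h2.mono fun y hy => hy.le) (by fun_prop), h1,
        ENNReal.toReal_ofReal h3.le]
    have key := disint_smul_map_withDensity ρ (f := fun x => ENNReal.ofReal x.2) (by fun_prop)
      (g := fun q => ENNReal.ofReal q.1) (by fun_prop) hT hTT (h := fun y : ℝ => y⁻¹)
      (by fun_prop) (ENNReal.ofReal (∫ p, p.2.1 ∂pi))⁻¹ hfg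
      (by rw [hfst]; exact hmpos.mono fun q hq => by simpa using hq)
      (by simp)
      (by
        rw [← hShat, Shat]
        have := Measure.smul_finite ((pi.withDensity fun p => ENNReal.ofReal p.2.1).map
          fun p => (p.1⁻¹, p.2.1⁻¹, p.2.2)) hc
        infer_instance)
    have hb := ae_smul_map_withDensity (g := fun q => ENNReal.ofReal q.1) hT hTT
      (ENNReal.ofReal (∫ p, p.2.1 ∂pi))⁻¹ hbary
    rw [← hShat] at key
    rw [ShatMu, hint, ← hfst]
    filter_upwards [key, hb] with q h1 h2
    rw [h1, S, h2]
  · have hmap : ShatMu mhat = (ENNReal.ofReal (∫ p, p.1 ∂mhat))⁻¹ •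
        (mhat.withDensity fun p => ENNReal.ofReal p.1).map (Prod.map (fun y : ℝ => y⁻¹) id) := rfl
    have hfpos : ∀ᵐ x ∂mhat.fst, 0 < x :=
      (ae_map_iff measurable_fst.aemeasurable measurableSet_Ioi).2 hmpos
    have key := disint_smul_map_withDensity mhat (f := fun p => ENNReal.ofReal p.1) (by fun_prop)
      (g := fun x => ENNReal.ofReal x) (by fun_prop) (e := fun y : ℝ => y⁻¹) (by fun_prop)
      inv_involutive (h := id) measurable_id (ENNReal.ofReal (∫ p, p.1 ∂mhat))⁻¹
      (by simp [disint_eq_condKernel])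
      (hfpos.mono fun q hq => by simpa using hq)
      (by simp)
      (by
        rw [hint]
        exact Measure.smul_finite _ hc)
    have hp := ae_smul_map_withDensity (g := fun x => ENNReal.ofReal x) (e := fun y : ℝ => y⁻¹)
      (by fun_prop) inv_involutive (ENNReal.ofReal (∫ p, p.1 ∂mhat))⁻¹ hfpos
    rw [← hmap] at key
    have hb : bary (mhat.map Prod.fst) = ∫ p, p.1 ∂mhat :=
      integral_map measurable_fst.aemeasurable (by fun_prop)
    rw [S, hb]
    filter_upwards [key, hp] with y h1 h2
    rw [h1, Measure.map_id, withDensity_const, smul_smul,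
      ENNReal.inv_mul_cancel (by simpa using h2) (by simp), one_smul]
end

section
/- Let μ̂ be a Borel probability measure on (0,∞) × [0,1] with ∫ x dμ̂(x,u) < ∞ and first marginal μ. Then for μ-almost every x₀ the following holds: for every η ∈ P₁((0,∞)) with barycenter b(η) = x₀, one has x₀ · C^{Ŝ(μ̂)}(S(η)) = C^{μ̂}(η). -/
open MeasureTheory Set

/-- The shadow cost `C^{μ̂}(η) = inf { ∫ (1-u)√(1+x₁²) dα : α ∈ M̂(δ_m ⊗ μ̂_m, η) }`
with `m = b(η)` and `μ̂_m` the disintegration of `μ̂` over its first marginal at `m`. -/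
noncomputable def shadowCost (mhat : Measure (ℝ × ℝ)) (eta : Measure ℝ) : ENNReal :=
  sInf {r | ∃ alpha : Measure (ℝ × ℝ × ℝ),
    MemMhatC ((Measure.dirac (bary eta)).prod (disint mhat (bary eta))) eta alpha ∧
    r = ∫⁻ p, ENNReal.ofReal ((1 - p.2.2) * Real.sqrt (1 + p.2.1 ^ 2)) ∂alpha}

open ProbabilityTheory
open scoped ENNReal

section ChangeOfMeasure

variable {α β : Type*} [MeasurableSpace α] [MeasurableSpace β]

lemma lintegral_smul_map_withDensity (μ : Measure α) (c : ℝ≥0∞) {w : α → ℝ≥0∞}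
    (hw : Measurable w) {T : α → β} (hT : Measurable T) {f : β → ℝ≥0∞} (hf : Measurable f) :
    ∫⁻ y, f y ∂(c • (μ.withDensity w).map T) = c * ∫⁻ x, w x * f (T x) ∂μ := by
  rw [lintegral_smul_measure, lintegral_map hf hT,
    lintegral_withDensity_eq_lintegral_mul _ hw (g := fun x => f (T x)) (hf.comp hT)]
  rfl

lemma ae_smul_map_withDensity_s17 {μ : Measure α} (c : ℝ≥0∞) {w : α → ℝ≥0∞}
    {T : α → β} (hT : Measurable T) {p : β → Prop} (hp : MeasurableSet {y | p y})
    (h : ∀ᵐ x ∂μ, p (T x)) :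
    ∀ᵐ y ∂(c • (μ.withDensity w).map T), p y := by
  refine Measure.ae_smul_measure ?_ c
  rw [ae_map_iff hT.aemeasurable hp]
  exact (withDensity_absolutelyContinuous μ w).ae_le h

lemma integral_smul_map_withDensity_ofReal (μ : Measure α) (c : ℝ≥0∞) {w : α → ℝ}
    (hw : Measurable w) (hpos : ∀ᵐ x ∂μ, 0 < w x) {T : α → β} (hT : Measurable T)
    {f : β → ℝ} (hf : Measurable f) :
    ∫ y, f y ∂(c • (μ.withDensity fun x => ENNReal.ofReal (w x)).map T) =
      c.toReal * ∫ x, w x * f (T x) ∂μ := by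
  rw [integral_smul_measure, integral_map hT.aemeasurable hf.aestronglyMeasurable,
    integral_withDensity_eq_integral_toReal_smul hw.ennreal_ofReal
      (by simp), smul_eq_mul]
  congr 1
  refine integral_congr_ae ?_
  filter_upwards [hpos] with x hx
  simp [ENNReal.toReal_ofReal hx.le]

lemma integral_pos_of_ae_pos {μ : Measure α} [IsProbabilityMeasure μ] {f : α → ℝ}
    (hf : Integrable f μ) (hpos : ∀ᵐ x ∂μ, 0 < f x) : 0 < ∫ x, f x ∂μ := by
  rw [integral_pos_iff_support_of_nonneg_ae (hpos.mono fun x hx => hx.le) hf]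
  have : Function.support f =ᵐ[μ] Set.univ := by
    filter_upwards [hpos] with x hx
    exact propext ⟨fun _ => trivial, fun _ => hx.ne'⟩
  rw [measure_congr this]
  simp

end ChangeOfMeasure

lemma ofReal_mul_ofReal_inv {x : ℝ} (hx : 0 < x) :
    ENNReal.ofReal x * ENNReal.ofReal x⁻¹ = 1 := by
  rw [← ENNReal.ofReal_mul hx.le, mul_inv_cancel₀ hx.ne', ENNReal.ofReal_one]

namespace MemP1

variable {eta : Measure ℝ}

lemma ae_pos (h : MemP1 eta) : ∀ᵐ x ∂eta, 0 < x := h.2.1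

lemma bary_pos (h : MemP1 eta) : 0 < bary eta :=
  have := h.1
  integral_pos_of_ae_pos (f := fun x => x) h.2.2 h.ae_pos

lemma lintegral_ofReal (h : MemP1 eta) :
    ∫⁻ x, ENNReal.ofReal x ∂eta = ENNReal.ofReal (bary eta) :=
  (ofReal_integral_eq_lintegral_ofReal (f := fun x => x) h.2.2
    (h.ae_pos.mono fun _ hx => hx.le)).symm

lemma bary_S (h : MemP1 eta) : bary (S eta) = (bary eta)⁻¹ := by
  have := h.1
  unfold S
  rw [bary, integral_smul_map_withDensity_ofReal eta _ (w := fun x => x) measurable_id h.ae_pos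
    measurable_inv (f := fun x => x) measurable_id]
  have : ∫ x, x * x⁻¹ ∂eta = ∫ _, (1 : ℝ) ∂eta := by
    refine integral_congr_ae ?_
    filter_upwards [h.ae_pos] with x hx
    exact mul_inv_cancel₀ hx.ne'
  rw [this]
  simp [ENNReal.toReal_ofReal h.bary_pos.le]

protected lemma S (h : MemP1 eta) : MemP1 (S eta) := by
  have := h.1
  have hpos := h.bary_pos
  have hT : Measurable fun x : ℝ => x⁻¹ := measurable_inv
  have hS : ∀ᵐ x ∂(S eta), 0 < x :=
    ae_smul_map_withDensity_s17 _ hT measurableSet_Ioi (h.ae_pos.mono fun x hx => inv_pos.2 hx)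
  refine ⟨⟨?_⟩, hS, ?_⟩
  · rw [← lintegral_one, S, lintegral_smul_map_withDensity _ _ ENNReal.measurable_ofReal hT
      measurable_const]
    simp only [mul_one]
    rw [h.lintegral_ofReal]
    exact ENNReal.inv_mul_cancel (by simpa using hpos) (by simp)
  · refine ⟨measurable_id.aestronglyMeasurable, ?_⟩
    rw [hasFiniteIntegral_iff_ofReal (f := id) (hS.mono fun _ hx => hx.le)]
    simp only [id]
    rw [S, lintegral_smul_map_withDensity _ _ ENNReal.measurable_ofReal hT
      ENNReal.measurable_ofReal]
    have : ∫⁻ x, ENNReal.ofReal x * ENNReal.ofReal x⁻¹ ∂eta = ∫⁻ _, 1 ∂eta := by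
      refine lintegral_congr_ae ?_
      filter_upwards [h.ae_pos] with x hx
      exact ofReal_mul_ofReal_inv hx
    rw [this]
    simp [hpos]

lemma S_S (h : MemP1 eta) : S (S eta) = eta := by
  have hT : Measurable fun x : ℝ => x⁻¹ := measurable_inv
  have hpos := h.bary_pos
  refine Measure.ext_of_lintegral _ fun f hf => ?_
  have key : ∫⁻ x, ENNReal.ofReal x * (ENNReal.ofReal x⁻¹ * f x⁻¹⁻¹) ∂eta = ∫⁻ x, f x ∂eta := by
    refine lintegral_congr_ae ?_
    filter_upwards [h.ae_pos] with x hx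
    rw [← mul_assoc, ofReal_mul_ofReal_inv hx, one_mul, inv_inv]
  rw [S, lintegral_smul_map_withDensity _ _ ENNReal.measurable_ofReal hT hf, h.bary_S, S,
    lintegral_smul_map_withDensity _ _ ENNReal.measurable_ofReal hT
      (f := fun x => ENNReal.ofReal x * f x⁻¹) (by fun_prop), ← mul_assoc, key,
    ← ENNReal.mul_inv (by simp) (by simp), mul_comm (ENNReal.ofReal _),
    ofReal_mul_ofReal_inv hpos]
  simp

end MemP1

/-- The cost of transporting `δ_m ⊗ k` to `eta`, where `m` is the barycenter of `eta`. -/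
noncomputable def fiberCost (k : Measure ℝ) (eta : Measure ℝ) : ℝ≥0∞ :=
  sInf {r | ∃ alpha : Measure (ℝ × ℝ × ℝ),
    MemMhatC ((Measure.dirac (bary eta)).prod k) eta alpha ∧
    r = ∫⁻ p, ENNReal.ofReal ((1 - p.2.2) * Real.sqrt (1 + p.2.1 ^ 2)) ∂alpha}

namespace MemMhatC

variable {k eta : Measure ℝ} {m : ℝ} {pi : Measure (ℝ × ℝ × ℝ)} {mhat : Measure (ℝ × ℝ)}

lemma integral_terminal (h : MemMhatC mhat eta pi) : ∫ p, p.2.1 ∂pi = bary eta := by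
  rw [bary, ← h.2.2, integral_map (by fun_prop) (by fun_prop)]

lemma ae_mem (h : MemMhatC mhat eta pi) :
    ∀ᵐ p ∂pi, 0 < p.1 ∧ 0 < p.2.1 ∧ p.2.2 ∈ Set.Icc (0:ℝ) 1 := h.1.1.2.1

lemma ae_fst_eq [IsProbabilityMeasure k]
    (h : MemMhatC ((Measure.dirac m).prod k) eta pi) : ∀ᵐ p ∂pi, p.1 = m := by
  have h1 : ∀ᵐ q ∂(pi.map fun p => (p.1, p.2.2)), q.1 = m := by
    rw [h.2.1]
    have : ∀ᵐ x ∂((Measure.dirac m).prod k).map Prod.fst, x = m := by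
      rw [Measure.map_fst_prod]
      simp
    exact ae_of_ae_map (by fun_prop) this
  exact ae_of_ae_map (by fun_prop) h1

lemma map_snd_Shat (h : MemMhatC mhat eta pi) :
    (Shat pi).map (fun p => p.2.1) = S eta := by
  refine Measure.ext_of_lintegral _ fun f hf => ?_
  rw [lintegral_map hf (by fun_prop), Shat, lintegral_smul_map_withDensity _ _
    (by fun_prop) (by fun_prop) (by fun_prop), S, lintegral_smul_map_withDensity _ _
    (by fun_prop) (by fun_prop) hf, h.integral_terminal]
  congr 1
  conv_rhs => rw [← h.2.2]
  rw [lintegral_map (by fun_prop) (by fun_prop)]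

lemma lintegral_snd_mul_indicator [IsProbabilityMeasure k]
    (h : MemMhatC ((Measure.dirac m).prod k) eta pi)
    {B : Set (ℝ × ℝ)} (hB : MeasurableSet B) :
    ∫⁻ p, ENNReal.ofReal p.2.1 * B.indicator 1 (p.1, p.2.2) ∂pi =
      ENNReal.ofReal m * ∫⁻ p, B.indicator 1 (p.1, p.2.2) ∂pi := by
  have := h.1.1.1
  let g : ℝ × ℝ → ℝ := B.indicator 1
  have hg : Measurable g := measurable_one.indicator hB
  have hgb : ∀ q, |g q| ≤ 1 := fun q => by
    by_cases hq : q ∈ B <;> simp [g, hq]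
  have hg0 : ∀ q, 0 ≤ g q := fun q => by
    by_cases hq : q ∈ B <;> simp [g, hq]
  have hge : ∀ q, B.indicator (1 : ℝ × ℝ → ℝ≥0∞) q = ENNReal.ofReal (g q) := fun q => by
    by_cases hq : q ∈ B <;> simp [g, hq]
  have hgm : Measurable fun p : ℝ × ℝ × ℝ => g (p.1, p.2.2) := hg.comp (by fun_prop)
  have hgi : Integrable (fun p : ℝ × ℝ × ℝ => g (p.1, p.2.2)) pi :=
    Integrable.of_bound hgm.aestronglyMeasurable 1 (by simpa using .of_forall fun p => hgb _)
  have hxi : Integrable (fun p : ℝ × ℝ × ℝ => g (p.1, p.2.2) * p.2.1) pi :=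
    h.1.1.2.2.bdd_mul hgm.aestronglyMeasurable (c := 1)
      (by simpa using .of_forall fun p => hgb _)
  have hmart := h.1.2 g hg ⟨1, hgb⟩
  have hmart' : ∫ p, (g (p.1, p.2.2) * p.2.1 - g (p.1, p.2.2) * m) ∂pi = 0 := by
    rw [← hmart]
    refine integral_congr_ae ?_
    filter_upwards [h.ae_fst_eq] with p hp
    rw [hp]; ring
  rw [integral_sub hxi (hgi.mul_const m), sub_eq_zero, integral_mul_const] at hmart'
  have e1 : ∫⁻ p, ENNReal.ofReal p.2.1 * B.indicator 1 (p.1, p.2.2) ∂pi =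
      ENNReal.ofReal (∫ p, g (p.1, p.2.2) * p.2.1 ∂pi) := by
    rw [ofReal_integral_eq_lintegral_ofReal hxi
      (h.ae_mem.mono fun p hp => mul_nonneg (hg0 _) hp.2.1.le)]
    refine lintegral_congr fun p => ?_
    rw [hge, ENNReal.ofReal_mul (hg0 _), mul_comm]
  have e2 : ∫⁻ p, B.indicator 1 (p.1, p.2.2) ∂pi =
      ENNReal.ofReal (∫ p, g (p.1, p.2.2) ∂pi) := by
    rw [ofReal_integral_eq_lintegral_ofReal hgi (.of_forall fun p => hg0 _)]
    exact lintegral_congr fun p => hge _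
  rw [e1, e2, hmart', ENNReal.ofReal_mul (integral_nonneg fun p => hg0 _), mul_comm]

lemma map_source_Shat [IsProbabilityMeasure k] (hm : 0 < m)
    (h : MemMhatC ((Measure.dirac m).prod k) eta pi) (hbary : bary eta = m) :
    (Shat pi).map (fun p => (p.1, p.2.2)) = (Measure.dirac m⁻¹).prod k := by
  have hT : Measurable fun q : ℝ × ℝ => (q.1⁻¹, q.2) := by fun_prop
  ext B hB
  have hind : Measurable (B.indicator (1 : ℝ × ℝ → ℝ≥0∞)) := measurable_one.indicator hB
  have hflip : ∀ q : ℝ × ℝ, B.indicator (1 : ℝ × ℝ → ℝ≥0∞) (q.1⁻¹, q.2) =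
      ((fun q : ℝ × ℝ => (q.1⁻¹, q.2)) ⁻¹' B).indicator 1 q := fun q => rfl
  have hsource : ∫⁻ p, B.indicator 1 (p.1⁻¹, p.2.2) ∂pi =
      ∫⁻ q, B.indicator (1 : ℝ × ℝ → ℝ≥0∞) (q.1⁻¹, q.2) ∂((Measure.dirac m).prod k) := by
    rw [← h.2.1, lintegral_map (f := fun q : ℝ × ℝ => B.indicator 1 (q.1⁻¹, q.2)) (hind.comp hT)
      (by fun_prop)]
  rw [← lintegral_indicator_one hB, ← lintegral_indicator_one hB,
    lintegral_map hind (by fun_prop), Shat, lintegral_smul_map_withDensity _ _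
    (by fun_prop) (by fun_prop) (by fun_prop), h.integral_terminal, hbary]
  have := h.lintegral_snd_mul_indicator (hT hB)
  simp only [← hflip (_, _)] at this
  rw [this, ← mul_assoc, ENNReal.inv_mul_cancel (by simpa using hm) (by simp), one_mul, hsource,
    lintegral_prod (fun q : ℝ × ℝ => B.indicator (1 : ℝ × ℝ → ℝ≥0∞) (q.1⁻¹, q.2))
      (hind.comp hT).aemeasurable, lintegral_prod _ hind.aemeasurable,
    lintegral_dirac, lintegral_dirac]

protected lemma Shat [IsProbabilityMeasure k] (heta : MemP1 eta) (hbary : bary eta = m)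
    (h : MemMhatC ((Measure.dirac m).prod k) eta pi) :
    MemMhatC ((Measure.dirac m⁻¹).prod k) (S eta) (Shat pi) := by
  have hm : 0 < m := hbary ▸ heta.bary_pos
  have hsnd := h.map_snd_Shat
  have hT : Measurable fun p : ℝ × ℝ × ℝ => (p.1⁻¹, p.2.1⁻¹, p.2.2) := by fun_prop
  refine ⟨⟨⟨?_, ?_, ?_⟩, ?_⟩, h.map_source_Shat hm hbary, hsnd⟩
  · have := heta.S.1
    rw [← hsnd] at this
    exact Measure.isProbabilityMeasure_of_map (f := fun p : ℝ × ℝ × ℝ => p.2.1)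
  · refine ae_smul_map_withDensity_s17 (p := fun p : ℝ × ℝ × ℝ =>
      0 < p.1 ∧ 0 < p.2.1 ∧ p.2.2 ∈ Set.Icc (0:ℝ) 1) _ hT ?_ ?_
    · measurability
    · filter_upwards [h.ae_mem] with p hp
      exact ⟨inv_pos.2 hp.1, inv_pos.2 hp.2.1, hp.2.2⟩
  · have := heta.S.2.2
    rw [← hsnd, integrable_map_measure (by fun_prop) (by fun_prop)] at this
    exact this
  · rintro g hg ⟨M, hM⟩
    have hmart := h.1.2 (fun q => g (q.1⁻¹, q.2)) (hg.comp (by fun_prop)) ⟨M, fun q => hM _⟩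
    rw [Shat, integral_smul_map_withDensity_ofReal (w := fun p : ℝ × ℝ × ℝ => p.2.1) _ _
      (by fun_prop) (h.ae_mem.mono fun p hp => hp.2.1) hT
      (f := fun p : ℝ × ℝ × ℝ => g (p.1, p.2.2) * (p.2.1 - p.1))
      ((hg.comp (by fun_prop)).mul (by fun_prop))]
    have : ∫ p, p.2.1 * (g (p.1⁻¹, p.2.2) * (p.2.1⁻¹ - p.1⁻¹)) ∂pi =
        ∫ p, (-m⁻¹) * (g (p.1⁻¹, p.2.2) * (p.2.1 - p.1)) ∂pi := by
      refine integral_congr_ae ?_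
      filter_upwards [h.ae_mem, h.ae_fst_eq] with p hp hpm
      have := hp.2.1.ne'
      rw [hpm]
      field_simp
      ring
    simp only [this]
    rw [integral_const_mul, hmart, mul_zero, mul_zero]

lemma cost_Shat (heta : MemP1 eta) (h : MemMhatC mhat eta pi) :
    ENNReal.ofReal (bary eta) *
        ∫⁻ p, ENNReal.ofReal ((1 - p.2.2) * Real.sqrt (1 + p.2.1 ^ 2)) ∂(Shat pi) =
      ∫⁻ p, ENNReal.ofReal ((1 - p.2.2) * Real.sqrt (1 + p.2.1 ^ 2)) ∂pi := by
  rw [Shat, lintegral_smul_map_withDensity _ _ (by fun_prop) (by fun_prop) (by fun_prop),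
    h.integral_terminal, ← mul_assoc,
    ENNReal.mul_inv_cancel (by simpa using heta.bary_pos) (by simp), one_mul]
  refine lintegral_congr_ae ?_
  filter_upwards [h.ae_mem] with p hp
  have hx := hp.2.1
  have hsqrt : p.2.1 * Real.sqrt (1 + p.2.1⁻¹ ^ 2) = Real.sqrt (1 + p.2.1 ^ 2) := by
    nth_rewrite 1 [← Real.sqrt_sq hx.le]
    rw [← Real.sqrt_mul (sq_nonneg _)]
    congr 1
    field_simp
    ring
  rw [← ENNReal.ofReal_mul hx.le, mul_left_comm, hsqrt]

end MemMhatC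

lemma ofReal_bary_mul_fiberCost_S_le (k : Measure ℝ) [IsProbabilityMeasure k] {eta : Measure ℝ}
    (heta : MemP1 eta) :
    ENNReal.ofReal (bary eta) * fiberCost k (S eta) ≤ fiberCost k eta := by
  refine le_sInf ?_
  rintro r ⟨pi, hpi, rfl⟩
  rw [← hpi.cost_Shat heta]
  gcongr
  refine sInf_le ⟨Shat pi, ?_, rfl⟩
  rw [heta.bary_S]
  exact hpi.Shat heta rfl

lemma ofReal_bary_mul_fiberCost_S (k : Measure ℝ) [IsProbabilityMeasure k] {eta : Measure ℝ}
    (heta : MemP1 eta) :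
    ENNReal.ofReal (bary eta) * fiberCost k (S eta) = fiberCost k eta := by
  refine le_antisymm (ofReal_bary_mul_fiberCost_S_le k heta) ?_
  have h := ofReal_bary_mul_fiberCost_S_le k heta.S
  rw [heta.S_S, heta.bary_S] at h
  calc fiberCost k eta
      = ENNReal.ofReal (bary eta) * (ENNReal.ofReal (bary eta)⁻¹ * fiberCost k eta) := by
        rw [← mul_assoc, ofReal_mul_ofReal_inv heta.bary_pos, one_mul]
    _ ≤ _ := by gcongr

lemma disint_eq_condKernel_s17 (rho : Measure (ℝ × ℝ)) [h : IsFiniteMeasure rho] :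
    disint rho = fun a => rho.condKernel a :=
  dif_pos h

lemma shadowCost_eq_fiberCost (mhat : Measure (ℝ × ℝ)) (eta : Measure ℝ) :
    shadowCost mhat eta = fiberCost (disint mhat (bary eta)) eta := rfl

lemma ShatMu_eq_compProd (mhat : Measure (ℝ × ℝ)) [IsFiniteMeasure mhat]
    [IsFiniteMeasure (ShatMu mhat)] :
    ShatMu mhat =
      (ShatMu mhat).fst ⊗ₘ mhat.condKernel.comap (fun x : ℝ => x⁻¹) measurable_inv := by
  refine Measure.ext_of_lintegral _ fun f hf => ?_
  have hin : Measurable fun x : ℝ => ∫⁻ u, f (x, u) ∂(mhat.condKernel x⁻¹) :=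
    hf.lintegral_kernel_prod_right'
      (κ := mhat.condKernel.comap (fun x : ℝ => x⁻¹) measurable_inv)
  rw [Measure.lintegral_compProd hf, Measure.fst]
  simp only [Kernel.comap_apply]
  rw [lintegral_map hin measurable_fst, ShatMu,
    lintegral_smul_map_withDensity _ _ (by fun_prop) (by fun_prop) hf,
    lintegral_smul_map_withDensity _ _ (by fun_prop) (by fun_prop)
      (f := fun p : ℝ × ℝ => ∫⁻ u, f (p.1, u) ∂(mhat.condKernel p.1⁻¹)) (hin.comp measurable_fst)]
  congr 1
  simp only [inv_inv]
  have hl : ∫⁻ p, ENNReal.ofReal p.1 * f (p.1⁻¹, p.2) ∂mhat =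
      ∫⁻ x, ENNReal.ofReal x * ∫⁻ u, f (x⁻¹, u) ∂(mhat.condKernel x) ∂mhat.fst := by
    conv_lhs => rw [← mhat.disintegrate mhat.condKernel]
    rw [Measure.lintegral_compProd (by fun_prop)]
    refine lintegral_congr fun x => ?_
    exact lintegral_const_mul (ENNReal.ofReal x) (by fun_prop)
  rw [hl, Measure.fst, lintegral_map (by fun_prop) measurable_fst]

namespace MemSource

variable {mhat : Measure (ℝ × ℝ)}

lemma ae_pos (h : MemSource mhat) : ∀ᵐ p ∂mhat, 0 < p.1 :=
  (show ∀ᵐ p ∂mhat, 0 < p.1 ∧ p.2 ∈ Set.Icc (0:ℝ) 1 from h.2.1).mono fun _ hp => hp.1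

lemma integral_pos (h : MemSource mhat) : 0 < ∫ p, p.1 ∂mhat :=
  have := h.1
  integral_pos_of_ae_pos h.2.2 h.ae_pos

lemma isFiniteMeasure_ShatMu (h : MemSource mhat) : IsFiniteMeasure (ShatMu mhat) := by
  constructor
  rw [← lintegral_one, ShatMu, lintegral_smul_map_withDensity _ _ (by fun_prop) (by fun_prop)
    measurable_const]
  simp only [mul_one]
  rw [← ofReal_integral_eq_lintegral_ofReal h.2.2 (h.ae_pos.mono fun _ hp => hp.le)]
  exact ENNReal.mul_lt_top (by simpa using h.integral_pos) (by simp)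

lemma ae_disint_ShatMu (h : MemSource mhat) :
    ∀ᵐ x ∂(mhat.map Prod.fst), disint (ShatMu mhat) x⁻¹ = disint mhat x := by
  have := h.1
  have := h.isFiniteMeasure_ShatMu
  rw [disint_eq_condKernel_s17, disint_eq_condKernel_s17]
  have key := eq_condKernel_of_measure_eq_compProd _ (ShatMu_eq_compProd mhat)
  have hfst : (ShatMu mhat).fst = (ENNReal.ofReal (∫ p, p.1 ∂mhat))⁻¹ •
      ((mhat.map Prod.fst).withDensity fun x => ENNReal.ofReal x).map fun x => x⁻¹ := by
    refine Measure.ext_of_lintegral _ fun f hf => ?_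
    rw [Measure.fst, lintegral_map hf measurable_fst, ShatMu,
      lintegral_smul_map_withDensity _ _ (by fun_prop) (by fun_prop) (by fun_prop),
      lintegral_smul_map_withDensity _ _ (by fun_prop) (by fun_prop) hf,
      lintegral_map (by fun_prop) measurable_fst]
  rw [hfst, Measure.ae_ennreal_smul_measure_iff (by simp)] at key
  have hkey := ae_of_ae_map (by fun_prop) key
  rw [ae_withDensity_iff (by fun_prop)] at hkey
  have hpos : ∀ᵐ x ∂(mhat.map Prod.fst), 0 < x :=
    (ae_map_iff measurable_fst.aemeasurable measurableSet_Ioi).2 h.ae_pos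
  filter_upwards [hkey, hpos] with x hx hx0
  rw [← hx (by simpa using hx0), Kernel.comap_apply, inv_inv]

end MemSource

/-- for `μ`-a.e. `x₀`, for every `η ∈ P₁((0,∞))` with `b(η) = x₀`,
`x₀ · C^{Ŝ(μ̂)}(S(η)) = C^{μ̂}(η)`. -/
theorem stmt17 (mhat : Measure (ℝ × ℝ)) (hmhat : MemSource mhat)
    (mu : Measure ℝ) (hmu : mu = mhat.map Prod.fst) :
    ∀ᵐ x0 ∂mu, ∀ eta : Measure ℝ, MemP1 eta → bary eta = x0 →
      ENNReal.ofReal x0 * shadowCost (ShatMu mhat) (S eta) = shadowCost mhat eta := by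
  subst hmu
  filter_upwards [hmhat.ae_disint_ShatMu] with x0 hx0 eta heta hbary
  have := hmhat.1
  have hk : IsProbabilityMeasure (disint mhat x0) := by
    rw [disint_eq_condKernel_s17]
    infer_instance
  rw [shadowCost_eq_fiberCost, shadowCost_eq_fiberCost, heta.bary_S, hbary, hx0, ← hbary]
  rw [← hbary] at hk
  exact ofReal_bary_mul_fiberCost_S _ heta
end
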